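/- arXiv:2509.19854 — 8 statements merged into one kernel-verified Lean document; each statement's English description precedes it below -/
import Mathlib

section
/- In a bounded join-semilattice L, the Nakano operation satisfies the L-mosaic diagonal absorption axiom (LM2): for all x : L, the union ⋃ a ∈ x ⊕ x, ⋃ b ∈ x ⊕ x, a ⊕ b equals x ⊕ x. -/
def nakano {L : Type*} [SemilatticeSup L] [OrderBot L] (x y : L) : Set L :=
  {z : L | x ⊔ y = x ⊔ z ∧ x ⊔ y = z ⊔ y}

theorem mem_nakano_self {L : Type*} [SemilatticeSup L] [OrderBot L] {x z : L} :
    z ∈ nakano x x ↔ z ≤ x := by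
  simp [nakano, eq_comm (a := x)]

theorem le_sup_of_mem_nakano {L : Type*} [SemilatticeSup L] [OrderBot L] {a b z : L}
    (h : z ∈ nakano a b) : z ≤ a ⊔ b :=
  h.1 ▸ le_sup_right

theorem nakano_LM2 {L : Type*} [SemilatticeSup L] [OrderBot L] :
    ∀ x : L, (⋃ a ∈ nakano x x, ⋃ b ∈ nakano x x, nakano a b) = nakano x x := by
  intro x
  ext z
  simp only [Set.mem_iUnion, exists_prop]
  constructor
  · rintro ⟨a, ha, b, hb, hz⟩
    rw [mem_nakano_self] at ha hb ⊢
    exact (le_sup_of_mem_nakano hz).trans (sup_le ha hb)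
  · intro hz
    have hx : x ∈ nakano x x := mem_nakano_self.2 le_rfl
    exact ⟨x, hx, x, hx, hz⟩
end

section
/- In a bounded join-semilattice L, the Nakano operation satisfies the L-mosaic uniqueness axiom (LM4), and the unique witness is the join: for all x y : L, there exists a unique z : L such that z ∈ x ⊕ y ∧ x ∈ z ⊕ z ∧ y ∈ z ⊕ z, and this unique z equals x ⊔ y. -/
theorem nakano_LM4 {L : Type*} [SemilatticeSup L] [OrderBot L] :
    ∀ x y : L,
      (∃! z : L, z ∈ nakano x y ∧ x ∈ nakano z z ∧ y ∈ nakano z z) ∧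
      (∀ z : L, (z ∈ nakano x y ∧ x ∈ nakano z z ∧ y ∈ nakano z z) ↔ z = x ⊔ y) := by
  intro x y
  have key : ∀ z : L,
      (z ∈ nakano x y ∧ x ∈ nakano z z ∧ y ∈ nakano z z) ↔ z = x ⊔ y := by
    intro z
    constructor
    · rintro ⟨⟨hz, -⟩, ⟨hx, -⟩, ⟨hy, -⟩⟩
      rw [sup_idem] at hx hy
      exact le_antisymm (hz ▸ le_sup_right)
        (sup_le (left_eq_sup.mp hx) (left_eq_sup.mp hy))
    · rintro rfl
      simp [nakano]
  exact ⟨⟨x ⊔ y, (key _).mpr rfl, fun z hz => (key z).mp hz⟩, key⟩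
end

section
/- In an L-mosaic, the induced relation ≼ is antisymmetric: for all x y : A, if x ∈ m y y and y ∈ m x x then x = y. -/
theorem lmosaic_le_antisymm {A : Type*} (e : A) (m : A → A → Set A)
    (hN : ∀ x y : A, (m x y).Nonempty)
    (hR : ∀ x y z : A, z ∈ m x y → x ∈ m z y ∧ y ∈ m x z)
    (hC : ∀ x y : A, m x y = m y x)
    (hLM1 : ∀ x : A, e ∈ m x x ∧ x ∈ m x x)
    (hLM2 : ∀ x : A, (⋃ a ∈ m x x, ⋃ b ∈ m x x, m a b) = m x x)
    (hLM3 : ∀ x y : A, (⋃ w ∈ m x y, m x w) ∩ (⋃ w ∈ m x y, m w y) ⊆ m x y)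
    (hLM4 : ∀ x y : A, ∃! z : A, z ∈ m x y ∧ x ∈ m z z ∧ y ∈ m z z) :
    ∀ x y : A, x ∈ m y y → y ∈ m x x → x = y := by
  intro x y hxy hyx
  have hx : x ∈ m x y := hC y x ▸ (hR x x y hyx).1
  have hy : y ∈ m x y := (hR y y x hxy).1
  exact (hLM4 x y).unique ⟨hx, (hLM1 x).2, hyx⟩ ⟨hy, hxy, (hLM1 y).2⟩
end

section
/- In an L-mosaic, the derived operation gives the least upper bound: for all x y t : A, sup x y is an upper bound of x and y (x ∈ m (sup x y) (sup x y) and y ∈ m (sup x y) (sup x y)), and if x ∈ m t t and y ∈ m t t then sup x y ∈ m t t. -/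
theorem lmosaic_sup_lub {A : Type*} (e : A) (m : A → A → Set A)
    (hN : ∀ x y : A, (m x y).Nonempty)
    (hR : ∀ x y z : A, z ∈ m x y → x ∈ m z y ∧ y ∈ m x z)
    (hC : ∀ x y : A, m x y = m y x)
    (hLM1 : ∀ x : A, e ∈ m x x ∧ x ∈ m x x)
    (hLM2 : ∀ x : A, (⋃ a ∈ m x x, ⋃ b ∈ m x x, m a b) = m x x)
    (hLM3 : ∀ x y : A, (⋃ w ∈ m x y, m x w) ∩ (⋃ w ∈ m x y, m w y) ⊆ m x y)
    (hLM4 : ∀ x y : A, ∃! z : A, z ∈ m x y ∧ x ∈ m z z ∧ y ∈ m z z)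
    (s : A → A → A)
    (hs : ∀ x y : A, s x y ∈ m x y ∧ x ∈ m (s x y) (s x y) ∧ y ∈ m (s x y) (s x y)) :
    ∀ x y t : A, x ∈ m (s x y) (s x y) ∧ y ∈ m (s x y) (s x y) ∧
      (x ∈ m t t → y ∈ m t t → s x y ∈ m t t) := by
  intro x y t
  obtain ⟨hsup, hx, hy⟩ := hs x y
  refine ⟨hx, hy, fun hxt hyt => ?_⟩
  rw [← hLM2 t]
  exact Set.mem_biUnion hxt (Set.mem_biUnion hyt hsup)
end

section
/- In an L-mosaic, the derived binary operation is associative: for all x y z : A, sup (sup x y) z = sup x (sup y z). Consequently (A, sup, e) is a bounded join-semilattice, even though the underlying multivalued operation m need not be associative. -/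
theorem lmosaic_sup_assoc {A : Type*} (e : A) (m : A → A → Set A)
    (hN : ∀ x y : A, (m x y).Nonempty)
    (hR : ∀ x y z : A, z ∈ m x y → x ∈ m z y ∧ y ∈ m x z)
    (hC : ∀ x y : A, m x y = m y x)
    (hLM1 : ∀ x : A, e ∈ m x x ∧ x ∈ m x x)
    (hLM2 : ∀ x : A, (⋃ a ∈ m x x, ⋃ b ∈ m x x, m a b) = m x x)
    (hLM3 : ∀ x y : A, (⋃ w ∈ m x y, m x w) ∩ (⋃ w ∈ m x y, m w y) ⊆ m x y)
    (hLM4 : ∀ x y : A, ∃! z : A, z ∈ m x y ∧ x ∈ m z z ∧ y ∈ m z z)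
    (s : A → A → A)
    (hs : ∀ x y : A, s x y ∈ m x y ∧ x ∈ m (s x y) (s x y) ∧ y ∈ m (s x y) (s x y)) :
    (∀ x y z : A, s (s x y) z = s x (s y z)) ∧
      (∀ x y : A, s x y = s y x) ∧ (∀ x : A, s x x = x) ∧
      (∀ x : A, s e x = x ∧ s x e = x) := by
  have closed : ∀ {x a b c : A}, a ∈ m x x → b ∈ m x x → c ∈ m a b → c ∈ m x x := by
    intro x a b c ha hb hc
    rw [← hLM2 x]
    simp only [Set.mem_iUnion]
    exact ⟨a, ha, b, hb, hc⟩
  have trans : ∀ {x y z : A}, x ∈ m y y → y ∈ m z z → x ∈ m z z :=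
    fun hxy hyz => closed hyz hyz hxy
  have antisymm : ∀ {x y : A}, x ∈ m y y → y ∈ m x x → x = y := by
    intro x y hxy hyx
    exact (hLM4 x y).unique ⟨(hR x x y hyx).2,
      (hLM1 x).2, hyx⟩ ⟨(hR y y x hxy).1, hxy, (hLM1 y).2⟩
  have left : ∀ x y : A, x ∈ m (s x y) (s x y) := fun x y => (hs x y).2.1
  have right : ∀ x y : A, y ∈ m (s x y) (s x y) := fun x y => (hs x y).2.2
  have least : ∀ {x y w : A}, x ∈ m w w → y ∈ m w w → s x y ∈ m w w :=
    fun hx hy => closed hx hy (hs _ _).1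
  refine ⟨fun x y z => antisymm ?_ ?_, fun x y => antisymm ?_ ?_, fun x => antisymm ?_ ?_,
    fun x => ⟨antisymm ?_ ?_, antisymm ?_ ?_⟩⟩
  · exact least (least (left _ _) (trans (left _ _) (right _ _)))
      (trans (right _ _) (right _ _))
  · exact least (trans (left _ _) (left _ _))
      (least (trans (right _ _) (left _ _)) (right _ _))
  · exact least (right _ _) (left _ _)
  · exact least (right _ _) (left _ _)
  · exact least (hLM1 x).2 (hLM1 x).2
  · exact left _ _
  · exact least (hLM1 x).1 (hLM1 x).2
  · exact right _ _
  · exact least (hLM1 x).2 (hLM1 x).1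
  · exact left _ _
end

section
/- In an L-mosaic, membership in m x y forces the Nakano equations for the derived join: for all x y z : A, if z ∈ m x y then sup x z = sup x y and sup z y = sup x y. -/
theorem lmosaic_nakano_eqs {A : Type*} (e : A) (m : A → A → Set A)
    (hN : ∀ x y : A, (m x y).Nonempty)
    (hR : ∀ x y z : A, z ∈ m x y → x ∈ m z y ∧ y ∈ m x z)
    (hC : ∀ x y : A, m x y = m y x)
    (hLM1 : ∀ x : A, e ∈ m x x ∧ x ∈ m x x)
    (hLM2 : ∀ x : A, (⋃ a ∈ m x x, ⋃ b ∈ m x x, m a b) = m x x)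
    (hLM3 : ∀ x y : A, (⋃ w ∈ m x y, m x w) ∩ (⋃ w ∈ m x y, m w y) ⊆ m x y)
    (hLM4 : ∀ x y : A, ∃! z : A, z ∈ m x y ∧ x ∈ m z z ∧ y ∈ m z z)
    (s : A → A → A)
    (hs : ∀ x y : A, s x y ∈ m x y ∧ x ∈ m (s x y) (s x y) ∧ y ∈ m (s x y) (s x y)) :
    ∀ x y z : A, z ∈ m x y → s x z = s x y ∧ s z y = s x y := by
  have closed : ∀ a b u : A, a ∈ m u u → b ∈ m u u → m a b ⊆ m u u := by
    intro a b u ha hb c hc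
    rw [← hLM2 u]
    simp only [Set.mem_iUnion]
    exact ⟨a, ha, b, hb, hc⟩
  have antisymm : ∀ a b : A, a ∈ m b b → b ∈ m a a → a = b := by
    intro a b hab hba
    refine (hLM4 a b).unique ⟨?_, (hLM1 a).2, hba⟩
      ⟨(hR b b a hab).1, hab, (hLM1 b).2⟩
    rw [hC]
    exact (hR a a b hba).1
  have sup_le : ∀ a b u : A, a ∈ m u u → b ∈ m u u → s a b ∈ m u u :=
    fun a b u ha hb => closed a b u ha hb (hs a b).1
  intro x y z hz
  obtain ⟨-, hx, hy⟩ := hs x y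
  have hzs : z ∈ m (s x y) (s x y) := closed x y _ hx hy hz
  obtain ⟨hxz, hyz⟩ := hR x y z hz
  constructor
  · obtain ⟨-, h₁, h₂⟩ := hs x z
    exact antisymm _ _ (sup_le _ _ _ hx hzs) (sup_le _ _ _ h₁ (closed _ _ _ h₁ h₂ hyz))
  · obtain ⟨-, h₁, h₂⟩ := hs z y
    exact antisymm _ _ (sup_le _ _ _ hzs hy) (sup_le _ _ _ (closed _ _ _ h₁ h₂ hxz) h₂)
end

section
/- Round-trip theorem (L-mosaic → bounded join-semilattice → L-mosaic): in an L-mosaic, the original multivalued operation is recovered by applying the Nakano construction to the derived join, i.e., for all x y : A, m x y = {z : A | sup x y = sup x z ∧ sup x y = sup z y}. -/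
theorem lmosaic_roundtrip {A : Type*} (e : A) (m : A → A → Set A)
    (hN : ∀ x y : A, (m x y).Nonempty)
    (hR : ∀ x y z : A, z ∈ m x y → x ∈ m z y ∧ y ∈ m x z)
    (hC : ∀ x y : A, m x y = m y x)
    (hLM1 : ∀ x : A, e ∈ m x x ∧ x ∈ m x x)
    (hLM2 : ∀ x : A, (⋃ a ∈ m x x, ⋃ b ∈ m x x, m a b) = m x x)
    (hLM3 : ∀ x y : A, (⋃ w ∈ m x y, m x w) ∩ (⋃ w ∈ m x y, m w y) ⊆ m x y)
    (hLM4 : ∀ x y : A, ∃! z : A, z ∈ m x y ∧ x ∈ m z z ∧ y ∈ m z z)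
    (s : A → A → A)
    (hs : ∀ x y : A, s x y ∈ m x y ∧ x ∈ m (s x y) (s x y) ∧ y ∈ m (s x y) (s x y)) :
    ∀ x y : A, m x y = {z : A | s x y = s x z ∧ s x y = s z y} := by
  have closed : ∀ {a b w z : A}, a ∈ m w w → b ∈ m w w → z ∈ m a b → z ∈ m w w := by
    intro a b w z ha hb hz
    rw [← hLM2 w]
    simp only [Set.mem_iUnion]
    exact ⟨a, ha, b, hb, hz⟩
  have antisymm : ∀ {a b : A}, a ∈ m b b → b ∈ m a a → a = b := by
    intro a b hab hba
    exact (hLM4 a b).unique ⟨(hR a a b hba).2, (hLM1 a).2, hba⟩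
      ⟨(hR b b a hab).1, hab, (hLM1 b).2⟩
  have sup_le : ∀ {a b w : A}, a ∈ m w w → b ∈ m w w → s a b ∈ m w w :=
    fun ha hb => closed ha hb (hs _ _).1
  have le_sup_of_mem : ∀ {a b z : A}, z ∈ m a b → z ∈ m (s a b) (s a b) :=
    fun hz => closed (hs _ _).2.1 (hs _ _).2.2 hz
  intro x y
  ext z
  constructor
  · intro hz
    obtain ⟨hx, hy⟩ := hR x y z hz
    exact ⟨antisymm (sup_le (hs x z).2.1 (le_sup_of_mem hy))
        (sup_le (hs x y).2.1 (le_sup_of_mem hz)),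
      antisymm (sup_le (le_sup_of_mem hx) (hs z y).2.2)
        (sup_le (le_sup_of_mem hz) (hs x y).2.2)⟩
  · rintro ⟨hxz, hzy⟩
    have h₁ : s x y ∈ m x z := hxz ▸ (hs x z).1
    have h₂ : s x y ∈ m z y := hzy ▸ (hs z y).1
    apply hLM3 x y
    simp only [Set.mem_inter_iff, Set.mem_iUnion]
    exact ⟨⟨s x y, (hs x y).1, (hR x z _ h₁).2⟩, ⟨s x y, (hs x y).1, (hR z y _ h₂).1⟩⟩
end

section
/- Round-trip theorem (bounded join-semilattice → L-mosaic → bounded join-semilattice): in a bounded join-semilattice L, applying the Nakano construction and then extracting the derived join recovers the original structure: for all x y : L, the unique z satisfying z ∈ x ⊕ y ∧ x ∈ z ⊕ z ∧ y ∈ z ⊕ z equals x ⊔ y, and the neutral element of the Nakano L-mosaic is ⊥ (i.e., x ⊕ ⊥ = {x} for all x). -/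
theorem mem_nakano_self_iff {L : Type*} [SemilatticeSup L] [OrderBot L] {x z : L} :
    x ∈ nakano z z ↔ x ≤ z := by
  simp [nakano]

theorem mem_nakano_and_mem_nakano_self_iff {L : Type*} [SemilatticeSup L] [OrderBot L]
    {x y z : L} :
    (z ∈ nakano x y ∧ x ∈ nakano z z ∧ y ∈ nakano z z) ↔ z = x ⊔ y := by
  simp only [mem_nakano_self_iff]
  constructor
  · rintro ⟨⟨hxz, -⟩, hx, -⟩
    rw [hxz, sup_eq_right.mpr hx]
  · rintro rfl
    simp [nakano]

theorem nakano_bot {L : Type*} [SemilatticeSup L] [OrderBot L] (x : L) :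
    nakano x (⊥ : L) = {x} := by
  ext z
  simp only [nakano, sup_bot_eq, Set.mem_ofPred_eq, Set.mem_singleton_iff]
  constructor
  · exact fun h => h.2.symm
  · rintro rfl
    simp

theorem nakano_roundtrip {L : Type*} [SemilatticeSup L] [OrderBot L] :
    (∀ x y : L,
      (∃! z : L, z ∈ nakano x y ∧ x ∈ nakano z z ∧ y ∈ nakano z z) ∧
      (∀ z : L, (z ∈ nakano x y ∧ x ∈ nakano z z ∧ y ∈ nakano z z) ↔ z = x ⊔ y)) ∧
    (∀ x : L, nakano x (⊥ : L) = {x}) := by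
  refine ⟨fun x y => ⟨?_, fun z => mem_nakano_and_mem_nakano_self_iff⟩, nakano_bot⟩
  exact ⟨x ⊔ y, mem_nakano_and_mem_nakano_self_iff.mpr rfl,
    fun z hz => mem_nakano_and_mem_nakano_self_iff.mp hz⟩
end
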